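/- Let $f(t) = t(1+t^2)^{-1/2}$ be the bounded transform function. Let $D$ be a self-adjoint element of a unital C*-algebra $A$, $K \in A$ self-adjoint, and let $J \subset A$ be a closed two-sided ideal with $K \in J$. Then $f(D+K) - f(D) \in J$. -/

import Mathlib

theorem aux_pow_mem {A : Type*} [Ring A] (J : TwoSidedIdeal A) (x y : A) (h : x - y ∈ J) (n : ℕ) :
    x ^ n - y ^ n ∈ J := by
  induction n with
  | zero => simp
  | succ n ih =>
    have e : x ^ (n + 1) - y ^ (n + 1) = x ^ n * (x - y) + (x ^ n - y ^ n) * y := by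
      rw [pow_succ, pow_succ]; noncomm_ring
    rw [e]
    exact J.add_mem (J.mul_mem_left _ _ h) (J.mul_mem_right _ _ ih)

theorem aux_poly_mem {A : Type*} [Ring A] [Algebra ℝ A] (J : TwoSidedIdeal A) (x y : A)
    (h : x - y ∈ J) (p : Polynomial ℝ) :
    Polynomial.aeval x p - Polynomial.aeval y p ∈ J := by
  induction p using Polynomial.induction_on' with
  | add p q hp hq =>
    rw [map_add, map_add, add_sub_add_comm]
    exact J.add_mem hp hq
  | monomial n a =>
    rw [Polynomial.aeval_monomial, Polynomial.aeval_monomial, ← mul_sub]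
    exact J.mul_mem_left _ _ (aux_pow_mem J x y h n)

theorem aux_approx {A : Type*} [CStarAlgebra A] (f : ℝ → ℝ) (hf : Continuous f) (p : Polynomial ℝ)
    (x : A) (hx : IsSelfAdjoint x) (R ε : ℝ) (hR : ‖x‖ * ‖(1 : A)‖ ≤ R) (hε : 0 ≤ ε)
    (hp : ∀ t ∈ Set.Icc (-R) R, |p.eval t - f t| < ε) :
    ‖Polynomial.aeval x p - cfc f x‖ ≤ ε := by
  rw [← cfc_polynomial p x hx, ← cfc_sub _ _ x (by fun_prop) (by fun_prop)]
  refine norm_cfc_le hε fun t ht => ?_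
  have h1 := spectrum.norm_le_norm_mul_of_mem ht
  exact (hp t (abs_le.mp (h1.trans hR))).le

/-- Let `f(t) = t (1 + t²)^{-1/2}` be the bounded transform.  Let `D`
be a self-adjoint element of a unital C*-algebra `A`, `K ∈ A` self-adjoint, and `J ⊆ A`
a closed two-sided ideal with `K ∈ J`.  Then `f(D + K) - f(D) ∈ J`. -/
theorem bounded_transform_diff_mem_ideal
    {A : Type*} [CStarAlgebra A]
    (J : TwoSidedIdeal A) (hJ : IsClosed (J : Set A))
    (D K : A) (hD : IsSelfAdjoint D) (hK : IsSelfAdjoint K) (hKJ : K ∈ J) :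
    cfc (fun t : ℝ => t / Real.sqrt (1 + t ^ 2)) (D + K) -
      cfc (fun t : ℝ => t / Real.sqrt (1 + t ^ 2)) D ∈ J := by
  have hf : Continuous (fun t : ℝ => t / Real.sqrt (1 + t ^ 2)) :=
    continuous_id.div (by fun_prop) fun t => (Real.sqrt_pos.mpr (by positivity)).ne'
  generalize (fun t : ℝ => t / Real.sqrt (1 + t ^ 2)) = f at hf ⊢
  rw [← SetLike.mem_coe, ← hJ.closure_eq, Metric.mem_closure_iff]
  intro ε hε
  obtain ⟨p, hp⟩ := exists_polynomial_near_of_continuousOn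
    (-(max (‖D + K‖ * ‖(1 : A)‖) (‖D‖ * ‖(1 : A)‖)))
    (max (‖D + K‖ * ‖(1 : A)‖) (‖D‖ * ‖(1 : A)‖)) f hf.continuousOn (ε / 3) (by positivity)
  refine ⟨_, aux_poly_mem J (D + K) D (by simpa using hKJ) p, ?_⟩
  have h1 := aux_approx f hf p (D + K) (hD.add hK) _ (ε / 3) (le_max_left _ _) (by positivity) hp
  have h2 := aux_approx f hf p D hD _ (ε / 3) (le_max_right _ _) (by positivity) hp
  rw [dist_comm, dist_eq_norm, sub_sub_sub_comm]
  exact (norm_sub_le _ _).trans_lt (by linarith)
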